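/- Let q be real with 0 < |q| < 1. For (r,s,t) ∈ ℕ×ℕ×ℤ, put n = (r+s+|t|)/2, i = (−r+s−t)/2, j = (−r+s+t)/2 (an element of Γ). Then: (a) if t ≥ 1, (−1)^{t₋} · U(λ_q(β_q) e^n_{i,j}) = −q^{s+t} [g(r+1)g(s+1)/(g(r+s+t+1)g(r+s+t+2))] e(r+1,s+1,t−1) + q^s [g(s+t)g(r+t)/(g(r+s+t)g(r+s+t+1))] e(r,s,t−1); (b) if t ≤ 0, (−1)^{t₋} · U(λ_q(β_q) e^n_{i,j}) = q^s [g(r+|t|+1)g(s+|t|+1)/(g(r+s+|t|+1)g(r+s+|t|+2))] e(r,s,t−1) − q^{s+|t|} [g(s)g(r)/(g(r+s+|t|)g(r+s+|t|+1))] e(r−1,s−1,t−1), where in (b) the second summand is omitted when r = 0 or s = 0, and vectors e with a negative first or second index are 0. Equivalently, this computes U λ_q(β_q) U* e(r,s,t). -/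

import Mathlib

noncomputable section

/-- The lattice Γ = {(n,i,j) : 2n ∈ ℕ, i,j ∈ {−n,…,n}}, in the integer coordinates
(m,a,b) = (2n, n+i, n+j): Γ = {(m,a,b) ∈ ℕ³ : a ≤ m ∧ b ≤ m}. -/
abbrev GammaIdx : Type := {x : ℕ × ℕ × ℕ // x.2.1 ≤ x.1 ∧ x.2.2 ≤ x.1}

/-- ℓ²(Γ) -/
abbrev l2G : Type := lp (fun _ : GammaIdx => ℂ) 2

/-- ℓ²(ℕ×ℕ×ℤ) -/
abbrev l2Z3 : Type := lp (fun _ : ℕ × ℕ × ℤ => ℂ) 2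

/-- The canonical orthonormal basis vector e^n_{i,j} of ℓ²(Γ), in coordinates
(m,a,b) = (2n, n+i, n+j); by convention it is 0 when (m,a,b) ∉ Γ. -/
def eG (m a b : ℕ) : l2G :=
  if h : a ≤ m ∧ b ≤ m then lp.single 2 (⟨(m, a, b), h⟩ : GammaIdx) 1 else 0

/-- The canonical orthonormal basis vector e(r,s,t) of ℓ²(ℕ×ℕ×ℤ); by convention
it is 0 when r < 0 or s < 0. -/
def eZ (r s t : ℤ) : l2Z3 :=
  if 0 ≤ r ∧ 0 ≤ s then lp.single 2 (r.toNat, s.toNat, t) 1 else 0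

/-- g(k) = (1 − q^{2k})^{1/2}  (so g(0) = 0). -/
def gq (q : ℝ) (k : ℕ) : ℝ := Real.sqrt (1 - q ^ (2 * k))

/-- a₊(n,i,j) = q^{2n+i+j+1} g(n−j+1)g(n−i+1)/(g(2n+1)g(2n+2)), in coordinates
(m,a,b) = (2n, n+i, n+j): a₊ = q^{a+b+1} g(m−b+1)g(m−a+1)/(g(m+1)g(m+2)). -/
def aP (q : ℝ) (m a b : ℕ) : ℝ :=
  q ^ (a + b + 1) * gq q (m - b + 1) * gq q (m - a + 1) / (gq q (m + 1) * gq q (m + 2))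

/-- a₋(n,i,j) = g(n+j)g(n+i)/(g(2n)g(2n+1)), i.e. a₋ = g(b)g(a)/(g(m)g(m+1)) (for m ≥ 1). -/
def aM (q : ℝ) (m a b : ℕ) : ℝ :=
  gq q b * gq q a / (gq q m * gq q (m + 1))

/-- b₊(n,i,j) = −q^{n+j} g(n−j+1)g(n+i+1)/(g(2n+1)g(2n+2)), i.e.
b₊ = −q^b g(m−b+1)g(a+1)/(g(m+1)g(m+2)). -/
def bP (q : ℝ) (m a b : ℕ) : ℝ :=
  -(q ^ b * gq q (m - b + 1) * gq q (a + 1)) / (gq q (m + 1) * gq q (m + 2))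

/-- b₋(n,i,j) = q^{n+i} g(n+j)g(n−i)/(g(2n)g(2n+1)), i.e.
b₋ = q^a g(b)g(m−a)/(g(m)g(m+1)) (for m ≥ 1). -/
def bM (q : ℝ) (m a b : ℕ) : ℝ :=
  q ^ a * gq q b * gq q (m - a) / (gq q m * gq q (m + 1))

/-- λ_q(α_q): in coordinates (m,a,b), e(m,a,b) ↦ a₊ e(m+1,a,b) + a₋ e(m−1,a−1,b−1),
the a₋ term being omitted when m = 0 (i.e. n = 0). -/
def IsLambdaAlpha (q : ℝ) (L : l2G →L[ℂ] l2G) : Prop :=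
  ∀ m a b : ℕ, a ≤ m → b ≤ m →
    L (eG m a b) = ((aP q m a b : ℝ) : ℂ) • eG (m + 1) a b +
      (if 1 ≤ m then ((aM q m a b : ℝ) : ℂ) • eG (m - 1) (a - 1) (b - 1) else 0)

/-- λ_q(β_q): in coordinates (m,a,b), e(m,a,b) ↦ b₊ e(m+1,a+1,b) + b₋ e(m−1,a,b−1),
the b₋ term being omitted when m = 0 (i.e. n = 0). -/
def IsLambdaBeta (q : ℝ) (L : l2G →L[ℂ] l2G) : Prop :=
  ∀ m a b : ℕ, a ≤ m → b ≤ m →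
    L (eG m a b) = ((bP q m a b : ℝ) : ℂ) • eG (m + 1) (a + 1) b +
      (if 1 ≤ m then ((bM q m a b : ℝ) : ℂ) • eG (m - 1) a (b - 1) else 0)

/-- The defining property of the unitary U : ℓ²(Γ) → ℓ²(ℕ×ℕ×ℤ):
U e^n_{i,j} = (−1)^{max(i,j)−j} e(n−max(i,j), n+min(i,j), j−i), i.e.
U e(m,a,b) = (−1)^{max(a,b)−b} e(m−max(a,b), min(a,b), b−a). -/
def IsU (U : l2G ≃ₗᵢ[ℂ] l2Z3) : Prop :=
  ∀ m a b : ℕ, a ≤ m → b ≤ m →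
    U (eG m a b) = ((-1 : ℂ) ^ (max a b - b)) •
      eZ ((m : ℤ) - (max a b : ℤ)) (min a b) ((b : ℤ) - (a : ℤ))

@[simp]
lemma gq_zero (q : ℝ) : gq q 0 = 0 := by simp [gq]

lemma IsU.apply_of_le {U : l2G ≃ₗᵢ[ℂ] l2Z3} (hU : IsU U) {m a b : ℕ} (hab : a ≤ b)
    (hb : b ≤ m) : U (eG m a b) = eZ ((m : ℤ) - b) a ((b : ℤ) - a) := by
  rw [hU m a b (hab.trans hb) hb, ← Nat.cast_max, ← Nat.cast_min, max_eq_right hab,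
    min_eq_left hab, Nat.sub_self, pow_zero, one_smul]

lemma IsU.apply_of_ge {U : l2G ≃ₗᵢ[ℂ] l2Z3} (hU : IsU U) {m a b : ℕ} (hba : b ≤ a)
    (ha : a ≤ m) :
    U (eG m a b) = ((-1 : ℂ) ^ (a - b)) • eZ ((m : ℤ) - a) b ((b : ℤ) - a) := by
  rw [hU m a b ha (hba.trans ha), ← Nat.cast_max, ← Nat.cast_min, max_eq_left hba,
    min_eq_right hba]

lemma neg_one_pow_mul_pow_succ (k : ℕ) : (-1 : ℂ) ^ k * (-1) ^ (k + 1) = -1 := by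
  rw [pow_succ, ← mul_assoc, ← mul_pow]
  simp

/-- for (r,s,t) ∈ ℕ×ℕ×ℤ, with (n,i,j) ∈ Γ corresponding to
(m,a,b) = (r+s+|t|, s+t₋, s+t₊):
(a) if t ≥ 1 then (−1)^{t₋} U(λ_q(β_q) e^n_{i,j}) =
  −q^{s+t} [g(r+1)g(s+1)/(g(r+s+t+1)g(r+s+t+2))] e(r+1,s+1,t−1)
  + q^s [g(s+t)g(r+t)/(g(r+s+t)g(r+s+t+1))] e(r,s,t−1);
(b) if t ≤ 0 then (−1)^{t₋} U(λ_q(β_q) e^n_{i,j}) =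
  q^s [g(r+|t|+1)g(s+|t|+1)/(g(r+s+|t|+1)g(r+s+|t|+2))] e(r,s,t−1)
  − q^{s+|t|} [g(s)g(r)/(g(r+s+|t|)g(r+s+|t|+1))] e(r−1,s−1,t−1),
the second summand in (b) being omitted when r = 0 or s = 0, and vectors e with a
negative first or second index being 0. -/
theorem stmt11 (q : ℝ) (h0 : 0 < |q|) (h1 : |q| < 1)
    (U : l2G ≃ₗᵢ[ℂ] l2Z3) (hU : IsU U)
    (Lβ : l2G →L[ℂ] l2G) (hLβ : IsLambdaBeta q Lβ)
    (r s : ℕ) (t : ℤ) :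
    (1 ≤ t →
      ((-1 : ℂ) ^ (-t).toNat) •
          U (Lβ (eG (r + s + t.natAbs) (s + (-t).toNat) (s + t.toNat))) =
        ((-(q ^ (s + t.toNat)) *
            (gq q (r + 1) * gq q (s + 1) /
              (gq q (r + s + t.toNat + 1) * gq q (r + s + t.toNat + 2))) : ℝ) : ℂ) •
            eZ ((r : ℤ) + 1) ((s : ℤ) + 1) (t - 1) +
        ((q ^ s *
            (gq q (s + t.toNat) * gq q (r + t.toNat) /
              (gq q (r + s + t.toNat) * gq q (r + s + t.toNat + 1))) : ℝ) : ℂ) •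
            eZ (r : ℤ) (s : ℤ) (t - 1)) ∧
    (t ≤ 0 →
      ((-1 : ℂ) ^ (-t).toNat) •
          U (Lβ (eG (r + s + t.natAbs) (s + (-t).toNat) (s + t.toNat))) =
        ((q ^ s *
            (gq q (r + t.natAbs + 1) * gq q (s + t.natAbs + 1) /
              (gq q (r + s + t.natAbs + 1) * gq q (r + s + t.natAbs + 2))) : ℝ) : ℂ) •
            eZ (r : ℤ) (s : ℤ) (t - 1) +
        (if r = 0 ∨ s = 0 then 0 else
          ((-(q ^ (s + t.natAbs)) *
              (gq q s * gq q r /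
                (gq q (r + s + t.natAbs) * gq q (r + s + t.natAbs + 1))) : ℝ) : ℂ) •
              eZ ((r : ℤ) - 1) ((s : ℤ) - 1) (t - 1))) := by
  constructor
  · intro ht
    obtain ⟨k, rfl⟩ : ∃ k : ℕ, t = k + 1 := ⟨(t - 1).toNat, by omega⟩
    have hneg : (-((k : ℤ) + 1)).toNat = 0 := by omega
    have hpos : ((k : ℤ) + 1).toNat = k + 1 := by omega
    have habs : ((k : ℤ) + 1).natAbs = k + 1 := by omega
    have hP : U (eG (r + s + (k + 1) + 1) (s + 1) (s + (k + 1))) =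
        eZ ((r : ℤ) + 1) ((s : ℤ) + 1) ((k : ℤ) + 1 - 1) := by
      rw [hU.apply_of_le (by omega) (by omega)]
      congr 1 <;> push_cast <;> ring
    have hM : U (eG (r + s + (k + 1) - 1) s (s + (k + 1) - 1)) =
        eZ (r : ℤ) (s : ℤ) ((k : ℤ) + 1 - 1) := by
      rw [hU.apply_of_le (by omega) (by omega)]
      congr 1 <;> omega
    rw [hneg, hpos, habs, pow_zero, one_smul, add_zero, hLβ _ _ _ (by omega) (by omega),
      if_pos (by omega), map_add, map_smul, map_smul, hP, hM, bP, bM,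
      show r + s + (k + 1) - (s + (k + 1)) = r by omega,
      show r + s + (k + 1) - s = r + (k + 1) by omega]
    congr 3 <;> ring
  · intro ht
    obtain ⟨k, rfl⟩ : ∃ k : ℕ, t = -k := ⟨(-t).toNat, by omega⟩
    have hneg : (-(-(k : ℤ))).toNat = k := by omega
    have hpos : (-(k : ℤ)).toNat = 0 := by omega
    have habs : (-(k : ℤ)).natAbs = k := by omega
    have hP : U (eG (r + s + k + 1) (s + k + 1) s) =
        ((-1 : ℂ) ^ (k + 1)) • eZ (r : ℤ) (s : ℤ) (-(k : ℤ) - 1) := by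
      rw [hU.apply_of_ge (by omega) (by omega)]
      congr 2 <;> omega
    rw [hneg, hpos, habs, add_zero, hLβ _ _ _ (by omega) (by omega), map_add, smul_add,
      map_smul, hP, bP, bM, show r + s + k - s = r + k by omega,
      show r + s + k - (s + k) = r by omega, smul_comm, smul_smul ((-1 : ℂ) ^ k),
      neg_one_pow_mul_pow_succ, smul_smul]
    congr 1
    · congr 1
      push_cast
      ring
    · by_cases hrs : r = 0 ∨ s = 0
      · rw [if_pos hrs]
        rcases hrs with rfl | rfl <;> simp
      · have hM : U (eG (r + s + k - 1) (s + k) (s - 1)) =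
            ((-1 : ℂ) ^ (k + 1)) • eZ ((r : ℤ) - 1) ((s : ℤ) - 1) (-(k : ℤ) - 1) := by
          rw [hU.apply_of_ge (by omega) (by omega)]
          congr 2 <;> omega
        rw [if_neg hrs, if_pos (by omega), map_smul, hM, smul_comm,
          smul_smul ((-1 : ℂ) ^ k), neg_one_pow_mul_pow_succ, smul_smul]
        congr 1
        push_cast
        ring
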